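/- Composite optimism of the softmax policy. Let κ > 0 and λ ≥ 0, let π^λ be the composite softmax policy with parameter λ, and assume that for every h ∈ {1,…,H} and (s,a) ∈ S×A: |(P̂_h V̄^{π^λ,r}_{h+1}[κ])(s,a) − (P_h V̄^{π^λ,r}_{h+1}[κ])(s,a)| ≤ C_r·β_h(s,a), |(P̂_h V̲^{π^λ,u}_{h+1})(s,a) − (P_h V̲^{π^λ,u}_{h+1})(s,a)| ≤ C_p·β_h(s,a), and |(P̂_h V̄^{π^λ,†}_{h+1})(s,a) − (P_h V̄^{π^λ,†}_{h+1})(s,a)| ≤ C_†·β_h(s,a). Then for every policy π': V̄^{π^λ,†}_1(s₁) + V̄^{π^λ,r}_1[κ](s₁) + λ·V̲^{π^λ,u}_1(s₁) ≥ V^{π',B_†·β}_{P,1}(s₁) + V^{π',r}_{P,1}[κ](s₁) + λ·V^{π',u−2C_p·β}_{P,1}(s₁). -/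

import Mathlib

/-- Entropy-regularized value function of policy `pol` for reward `g` (backward recursion on
the number of remaining steps). -/
noncomputable def Vaux {S A : Type*} [Fintype S] [Fintype A]
    (P : ℕ → S → A → S → ℝ) (pol : ℕ → S → A → ℝ) (g : ℕ → S → A → ℝ) (κ : ℝ) :
    ℕ → ℕ → S → ℝ
  | 0, _, _ => 0
  | n + 1, h, s => ∑ a, pol h s a *
      ((g h s a + ∑ s', P h s a s' * Vaux P pol g κ n (h + 1) s')
        - κ * Real.log (pol h s a))

/-- `Vval H P pol g κ h s = V^{pol,g}_{P,h}[κ](s)` for a horizon-`H` MDP. -/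
noncomputable def Vval {S A : Type*} [Fintype S] [Fintype A] (H : ℕ)
    (P : ℕ → S → A → S → ℝ) (pol : ℕ → S → A → ℝ) (g : ℕ → S → A → ℝ) (κ : ℝ)
    (h : ℕ) (s : S) : ℝ :=
  Vaux P pol g κ (H + 1 - h) h s

/-- Joint backward recursion (on the number of remaining steps) computing, for the composite
softmax policy `π^λ_h(·|s) = softmax((Q̄^{π^λ,†}_h(s,·) + Q̄^{π^λ,r}_h[κ](s,·) + λ·Q̲^{π^λ,u}_h(s,·))/κ)`
built from the clipped value functions, the triple `(V̄^{π^λ,†}_h(s), V̄^{π^λ,r}_h[κ](s), V̲^{π^λ,u}_h(s))`. -/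
noncomputable def ClipTripleAux {S A : Type*} [Fintype S] [Fintype A]
    (Phat : ℕ → (S → ℝ) → S → A → ℝ) (r u β : ℕ → S → A → ℝ)
    (Cr Cp Cd Bd κ lam : ℝ) (H : ℕ) :
    ℕ → ℕ → S → ℝ × ℝ × ℝ
  | 0, _, _ => (0, 0, 0)
  | n + 1, h, s =>
    let Qd : A → ℝ := fun a => Bd * β h s a +
      min (max (Cd * β h s a +
        Phat h (fun s' => (ClipTripleAux Phat r u β Cr Cp Cd Bd κ lam H n (h + 1) s').1) s a) 0)
        (Bd * ((H : ℝ) - h))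
    let Qr : A → ℝ := fun a => r h s a +
      min (max (Cr * β h s a +
        Phat h (fun s' => (ClipTripleAux Phat r u β Cr Cp Cd Bd κ lam H n (h + 1) s').2.1) s a) 0)
        (((H : ℝ) - h) * (1 + κ * Real.log (Fintype.card A)))
    let Qu : A → ℝ := fun a => u h s a +
      min (max (-(Cp * β h s a) +
        Phat h (fun s' => (ClipTripleAux Phat r u β Cr Cp Cd Bd κ lam H n (h + 1) s').2.2) s a) 0)
        ((H : ℝ) - h)
    let pol : A → ℝ := fun a =>
      Real.exp ((Qd a + Qr a + lam * Qu a) / κ)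
        / ∑ a', Real.exp ((Qd a' + Qr a' + lam * Qu a') / κ)
    (∑ a, pol a * Qd a,
     ∑ a, pol a * (Qr a - κ * Real.log (pol a)),
     ∑ a, pol a * Qu a)

/-- Clipped value-function triple `(V̄^{π^λ,†}_h, V̄^{π^λ,r}_h[κ], V̲^{π^λ,u}_h)` of the composite
softmax policy with parameter `λ`, at step `h` of a horizon-`H` MDP. -/
noncomputable def ClipTripleV {S A : Type*} [Fintype S] [Fintype A]
    (Phat : ℕ → (S → ℝ) → S → A → ℝ) (r u β : ℕ → S → A → ℝ)
    (Cr Cp Cd Bd κ lam : ℝ) (H : ℕ) (h : ℕ) (s : S) : ℝ × ℝ × ℝ :=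
  ClipTripleAux Phat r u β Cr Cp Cd Bd κ lam H (H + 1 - h) h s

theorem sum_mul_log_sub_log_nonpos {A : Type*} [Fintype A] (p w : A → ℝ)
    (hp : ∀ a, 0 ≤ p a) (hp1 : ∑ a, p a = 1) (hw : ∀ a, 0 < w a) (hw1 : ∑ a, w a = 1) :
    ∑ a, p a * (Real.log (w a) - Real.log (p a)) ≤ 0 := by
  have key : ∀ a, p a * (Real.log (w a) - Real.log (p a)) ≤ w a - p a := by
    intro a
    rcases (hp a).eq_or_lt with h | h
    · simp [← h, (hw a).le]
    · rw [← Real.log_div (hw a).ne' h.ne']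
      have h1 := mul_le_mul_of_nonneg_left
        (Real.log_le_sub_one_of_pos (div_pos (hw a) h)) h.le
      rwa [mul_sub, mul_div_cancel₀ _ h.ne', mul_one] at h1
  calc _ ≤ ∑ a, (w a - p a) := Finset.sum_le_sum fun a _ => key a
    _ = 0 := by rw [Finset.sum_sub_distrib, hp1, hw1, sub_self]

theorem neg_sum_mul_log_le_log_card {A : Type*} [Fintype A] [Nonempty A] (p : A → ℝ)
    (hp : ∀ a, 0 ≤ p a) (hp1 : ∑ a, p a = 1) :
    -∑ a, p a * Real.log (p a) ≤ Real.log (Fintype.card A) := by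
  have hc : (0 : ℝ) < Fintype.card A := Nat.cast_pos.2 Fintype.card_pos
  have h := sum_mul_log_sub_log_nonpos p (fun _ => (Fintype.card A : ℝ)⁻¹) hp hp1
    (fun _ => inv_pos.2 hc) (by simp [hc.ne'])
  simp only [mul_sub, Finset.sum_sub_distrib, ← Finset.sum_mul, hp1, Real.log_inv] at h
  linarith

/-- The softmax distribution of `q / κ`. -/
noncomputable def softmaxDist {A : Type*} [Fintype A] (q : A → ℝ) (κ : ℝ) (a : A) : ℝ :=
  Real.exp (q a / κ) / ∑ a', Real.exp (q a' / κ)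

theorem sum_exp_pos {A : Type*} [Fintype A] [Nonempty A] (f : A → ℝ) :
    0 < ∑ a, Real.exp (f a) :=
  Finset.sum_pos (fun _ _ => Real.exp_pos _) Finset.univ_nonempty

theorem softmaxDist_pos {A : Type*} [Fintype A] [Nonempty A] (q : A → ℝ) (κ : ℝ) (a : A) :
    0 < softmaxDist q κ a :=
  div_pos (Real.exp_pos _) (sum_exp_pos _)

theorem sum_softmaxDist {A : Type*} [Fintype A] [Nonempty A] (q : A → ℝ) (κ : ℝ) :
    ∑ a, softmaxDist q κ a = 1 := by
  simp only [softmaxDist, ← Finset.sum_div]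
  exact div_self (sum_exp_pos _).ne'

/-- Gibbs variational principle: the softmax maximizes the entropy-regularized expectation. -/
theorem sum_mul_sub_log_le_softmaxDist {A : Type*} [Fintype A] [Nonempty A] (q : A → ℝ) {κ : ℝ}
    (hκ : 0 < κ) (p : A → ℝ) (hp : ∀ a, 0 ≤ p a) (hp1 : ∑ a, p a = 1) :
    ∑ a, p a * (q a - κ * Real.log (p a))
      ≤ ∑ a, softmaxDist q κ a * (q a - κ * Real.log (softmaxDist q κ a)) := by
  set Z := ∑ a, Real.exp (q a / κ) with hZ
  have hlog : ∀ a, q a = κ * Real.log (softmaxDist q κ a) + κ * Real.log Z := by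
    intro a
    rw [softmaxDist, Real.log_div (Real.exp_pos _).ne' (sum_exp_pos _).ne', Real.log_exp, ← hZ]
    field_simp
    ring
  have hsoft : ∑ a, softmaxDist q κ a * (q a - κ * Real.log (softmaxDist q κ a))
      = κ * Real.log Z := by
    have : ∀ a, q a - κ * Real.log (softmaxDist q κ a) = κ * Real.log Z :=
      fun a => by linarith [hlog a]
    simp only [this, ← Finset.sum_mul, sum_softmaxDist, one_mul]
  have hgap := mul_nonpos_of_nonneg_of_nonpos hκ.le
    (sum_mul_log_sub_log_nonpos p _ hp hp1 (softmaxDist_pos q κ) (sum_softmaxDist q κ))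
  have hsplit : ∑ a, p a * (q a - κ * Real.log (p a))
      = κ * ∑ a, p a * (Real.log (softmaxDist q κ a) - Real.log (p a)) + κ * Real.log Z := by
    rw [← one_mul (κ * Real.log Z), ← hp1, Finset.sum_mul, Finset.mul_sum,
      ← Finset.sum_add_distrib]
    refine Finset.sum_congr rfl fun a _ => ?_
    linear_combination p a * hlog a
  linarith

theorem sum_mul_le_of_le {A : Type*} [Fintype A] {p f : A → ℝ} {c : ℝ}
    (hp : ∀ a, 0 ≤ p a) (hp1 : ∑ a, p a = 1) (hf : ∀ a, f a ≤ c) : ∑ a, p a * f a ≤ c := by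
  calc _ ≤ ∑ a, p a * c := Finset.sum_le_sum fun a _ => mul_le_mul_of_nonneg_left (hf a) (hp a)
    _ = c := by rw [← Finset.sum_mul, hp1, one_mul]

theorem le_clip_add_of_abs_sub_le {x y c m : ℝ} (h : |x - y| ≤ c) (hy : y ≤ m) :
    y ≤ min (max (c + x) 0) m :=
  le_min (le_max_of_le_left (by linarith [(abs_le.1 h).1])) hy

theorem sub_le_clip_neg_add_of_abs_sub_le {x y c m : ℝ} (h : |x - y| ≤ c) (hy : y ≤ m) :
    y - 2 * c ≤ min (max (-c + x) 0) m :=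
  le_min (le_max_of_le_left (by linarith [(abs_le.1 h).1]))
    (by linarith [(abs_nonneg _).trans h])

section ClipTriple

variable {S A : Type*} [Fintype S] [Fintype A]

/-- One step of the backward recursion of `ClipTripleAux`, given its action values. -/
theorem exists_clipTripleAux_succ (Phat : ℕ → (S → ℝ) → S → A → ℝ) (r u β : ℕ → S → A → ℝ)
    (Cr Cp Cd Bd κ lam : ℝ) (H n h : ℕ) (hn : n + h = H) (s : S) :
    ∃ Qd Qr Qu : A → ℝ,
      (∀ a, Qd a = Bd * β h s a + min (max (Cd * β h s a + Phat h
        (fun s' => (ClipTripleAux Phat r u β Cr Cp Cd Bd κ lam H n (h + 1) s').1) s a) 0)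
          (Bd * n)) ∧
      (∀ a, Qr a = r h s a + min (max (Cr * β h s a + Phat h
        (fun s' => (ClipTripleAux Phat r u β Cr Cp Cd Bd κ lam H n (h + 1) s').2.1) s a) 0)
          (n * (1 + κ * Real.log (Fintype.card A)))) ∧
      (∀ a, Qu a = u h s a + min (max (-(Cp * β h s a) + Phat h
        (fun s' => (ClipTripleAux Phat r u β Cr Cp Cd Bd κ lam H n (h + 1) s').2.2) s a) 0)
          n) ∧
      ClipTripleAux Phat r u β Cr Cp Cd Bd κ lam H (n + 1) h s =
        (∑ a, softmaxDist (fun a => Qd a + Qr a + lam * Qu a) κ a * Qd a,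
         ∑ a, softmaxDist (fun a => Qd a + Qr a + lam * Qu a) κ a *
          (Qr a - κ * Real.log (softmaxDist (fun a => Qd a + Qr a + lam * Qu a) κ a)),
         ∑ a, softmaxDist (fun a => Qd a + Qr a + lam * Qu a) κ a * Qu a) := by
  have hH : (n : ℝ) = (H : ℝ) - h := by rw [← hn]; push_cast; ring
  rw [hH]
  exact ⟨_, _, _, fun _ => rfl, fun _ => rfl, fun _ => rfl, rfl⟩

theorem clipTripleAux_le [Nonempty A] (Phat : ℕ → (S → ℝ) → S → A → ℝ) (r u β : ℕ → S → A → ℝ)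
    (Cr Cp Cd Bd κ lam : ℝ) (hBd : 0 ≤ Bd) (hκ : 0 ≤ κ) (hr : ∀ h s a, r h s a ≤ 1)
    (hu : ∀ h s a, u h s a ≤ 1) (hβ : ∀ h s a, β h s a ≤ 1) (H n h : ℕ) (hn : n + h = H + 1)
    (s : S) :
    (ClipTripleAux Phat r u β Cr Cp Cd Bd κ lam H n h s).1 ≤ Bd * n ∧
    (ClipTripleAux Phat r u β Cr Cp Cd Bd κ lam H n h s).2.1
      ≤ n * (1 + κ * Real.log (Fintype.card A)) ∧
    (ClipTripleAux Phat r u β Cr Cp Cd Bd κ lam H n h s).2.2 ≤ n := by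
  rcases n with _ | n
  · simp [ClipTripleAux]
  obtain ⟨Qd, Qr, Qu, hQd, hQr, hQu, hV⟩ :=
    exists_clipTripleAux_succ Phat r u β Cr Cp Cd Bd κ lam H n h (by omega) s
  rw [hV]
  dsimp only
  set p := softmaxDist (fun a => Qd a + Qr a + lam * Qu a) κ
  have hp : ∀ a, 0 ≤ p a := fun a => (softmaxDist_pos _ _ a).le
  have hp1 : ∑ a, p a = 1 := sum_softmaxDist _ _
  push_cast
  refine ⟨sum_mul_le_of_le hp hp1 fun a => ?_, ?_, sum_mul_le_of_le hp hp1 fun a => ?_⟩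
  · rw [hQd]
    linarith [min_le_right (max (Cd * β h s a + Phat h (fun s' =>
      (ClipTripleAux Phat r u β Cr Cp Cd Bd κ lam H n (h + 1) s').1) s a) 0) (Bd * n),
      mul_le_mul_of_nonneg_left (hβ h s a) hBd]
  · have hQ : ∑ a, p a * Qr a ≤ 1 + n * (1 + κ * Real.log (Fintype.card A)) :=
      sum_mul_le_of_le hp hp1 fun a => by
        rw [hQr]
        exact add_le_add (hr h s a) (min_le_right _ _)
    have hent := mul_le_mul_of_nonneg_left (neg_sum_mul_log_le_log_card p hp hp1) hκ
    have hsplit : ∑ a, p a * (Qr a - κ * Real.log (p a))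
        = ∑ a, p a * Qr a + κ * -∑ a, p a * Real.log (p a) := by
      rw [← Finset.sum_neg_distrib, Finset.mul_sum, ← Finset.sum_add_distrib]
      exact Finset.sum_congr rfl fun a _ => by ring
    linarith
  · rw [hQu, add_comm (n : ℝ)]
    exact add_le_add (hu h s a) (min_le_right _ _)

theorem composite_Vaux_le_clipTripleAux [Nonempty A] (P : ℕ → S → A → S → ℝ)
    (hP : ∀ h s a, (∀ s', 0 ≤ P h s a s') ∧ ∑ s', P h s a s' = 1)
    (Phat : ℕ → (S → ℝ) → S → A → ℝ) (r u β : ℕ → S → A → ℝ)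
    (Cr Cp Cd Bd κ lam : ℝ) (hBd : 0 ≤ Bd) (hκ : 0 < κ) (hlam : 0 ≤ lam)
    (hr : ∀ h s a, r h s a ≤ 1) (hu : ∀ h s a, u h s a ≤ 1) (hβ : ∀ h s a, β h s a ≤ 1) (H : ℕ)
    (haccR : ∀ h ∈ Finset.Icc 1 H, ∀ s a,
      |Phat h (fun s' => (ClipTripleV Phat r u β Cr Cp Cd Bd κ lam H (h + 1) s').2.1) s a
        - ∑ s', P h s a s' * (ClipTripleV Phat r u β Cr Cp Cd Bd κ lam H (h + 1) s').2.1|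
          ≤ Cr * β h s a)
    (haccU : ∀ h ∈ Finset.Icc 1 H, ∀ s a,
      |Phat h (fun s' => (ClipTripleV Phat r u β Cr Cp Cd Bd κ lam H (h + 1) s').2.2) s a
        - ∑ s', P h s a s' * (ClipTripleV Phat r u β Cr Cp Cd Bd κ lam H (h + 1) s').2.2|
          ≤ Cp * β h s a)
    (haccD : ∀ h ∈ Finset.Icc 1 H, ∀ s a,
      |Phat h (fun s' => (ClipTripleV Phat r u β Cr Cp Cd Bd κ lam H (h + 1) s').1) s a
        - ∑ s', P h s a s' * (ClipTripleV Phat r u β Cr Cp Cd Bd κ lam H (h + 1) s').1|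
          ≤ Cd * β h s a)
    (pol : ℕ → S → A → ℝ) (hpol : ∀ h s, (∀ a, 0 ≤ pol h s a) ∧ ∑ a, pol h s a = 1)
    (n h : ℕ) (hn : n + h = H + 1) (hh : 1 ≤ h) (s : S) :
    Vaux P pol (fun h s a => Bd * β h s a) 0 n h s + Vaux P pol r κ n h s
        + lam * Vaux P pol (fun h s a => u h s a - 2 * Cp * β h s a) 0 n h s
      ≤ (ClipTripleAux Phat r u β Cr Cp Cd Bd κ lam H n h s).1
        + (ClipTripleAux Phat r u β Cr Cp Cd Bd κ lam H n h s).2.1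
        + lam * (ClipTripleAux Phat r u β Cr Cp Cd Bd κ lam H n h s).2.2 := by
  induction n generalizing h s with
  | zero => simp [Vaux, ClipTripleAux]
  | succ n ih =>
    obtain ⟨Qd, Qr, Qu, hQd, hQr, hQu, hV⟩ :=
      exists_clipTripleAux_succ Phat r u β Cr Cp Cd Bd κ lam H n h (by omega) s
    rw [hV]
    dsimp only
    set q : A → ℝ := fun a => Qd a + Qr a + lam * Qu a with hq
    have hmem : h ∈ Finset.Icc 1 H := Finset.mem_Icc.2 ⟨hh, by omega⟩
    have hsub : H + 1 - (h + 1) = n := by omega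
    have haccR := haccR h hmem s
    have haccU := haccU h hmem s
    have haccD := haccD h hmem s
    simp only [ClipTripleV, hsub] at haccR haccU haccD
    set W := ClipTripleAux Phat r u β Cr Cp Cd Bd κ lam H n (h + 1) with hW
    have hWle := clipTripleAux_le Phat r u β Cr Cp Cd Bd κ lam hBd hκ.le hr hu hβ H n (h + 1)
      (by omega)
    have ih := ih (h + 1) (by omega) (by omega)
    rw [← hW] at hWle ih
    set D := Vaux P pol (fun h s a => Bd * β h s a) 0 n (h + 1) with hD
    set R := Vaux P pol r κ n (h + 1) with hR
    set U := Vaux P pol (fun h s a => u h s a - 2 * Cp * β h s a) 0 n (h + 1) with hU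
    have hstep : ∀ a, (Bd * β h s a + ∑ s', P h s a s' * D s')
        + (r h s a + ∑ s', P h s a s' * R s')
        + lam * (u h s a - 2 * Cp * β h s a + ∑ s', P h s a s' * U s') ≤ q a := by
      intro a
      have h1 := le_clip_add_of_abs_sub_le (haccD a)
        (sum_mul_le_of_le (hP h s a).1 (hP h s a).2 fun s' => (hWle s').1)
      have h2 := le_clip_add_of_abs_sub_le (haccR a)
        (sum_mul_le_of_le (hP h s a).1 (hP h s a).2 fun s' => (hWle s').2.1)
      have h3 := mul_le_mul_of_nonneg_left (sub_le_clip_neg_add_of_abs_sub_le (haccU a)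
        (sum_mul_le_of_le (hP h s a).1 (hP h s a).2 fun s' => (hWle s').2.2)) hlam
      have hsum : ∑ s', P h s a s' * D s' + ∑ s', P h s a s' * R s'
          + lam * ∑ s', P h s a s' * U s'
          ≤ ∑ s', P h s a s' * (W s').1 + ∑ s', P h s a s' * (W s').2.1
          + lam * ∑ s', P h s a s' * (W s').2.2 := by
        simp only [Finset.mul_sum, ← Finset.sum_add_distrib]
        refine Finset.sum_le_sum fun s' _ => ?_
        linarith [mul_le_mul_of_nonneg_left (ih s') ((hP h s a).1 s')]
      simp only [hq, hQd, hQr, hQu]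
      linarith
    calc _ = ∑ a, pol h s a * (((Bd * β h s a + ∑ s', P h s a s' * D s')
            + (r h s a + ∑ s', P h s a s' * R s')
            + lam * (u h s a - 2 * Cp * β h s a + ∑ s', P h s a s' * U s'))
            - κ * Real.log (pol h s a)) := by
          simp only [Vaux, ← hD, ← hR, ← hU]
          rw [Finset.mul_sum, ← Finset.sum_add_distrib, ← Finset.sum_add_distrib]
          exact Finset.sum_congr rfl fun a _ => by ring
      _ ≤ ∑ a, pol h s a * (q a - κ * Real.log (pol h s a)) :=
          Finset.sum_le_sum fun a _ => mul_le_mul_of_nonneg_left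
            (sub_le_sub_right (hstep a) _) ((hpol h s).1 a)
      _ ≤ ∑ a, softmaxDist q κ a * (q a - κ * Real.log (softmaxDist q κ a)) :=
          sum_mul_sub_log_le_softmaxDist q hκ _ (hpol h s).1 (hpol h s).2
      _ = _ := by
          rw [Finset.mul_sum, ← Finset.sum_add_distrib, ← Finset.sum_add_distrib]
          refine Finset.sum_congr rfl fun a _ => ?_
          rw [hq]
          ring

end ClipTriple

/-- **Composite optimism of the softmax policy.**
If the estimated transition operator `P̂` is accurate on the clipped value functions of the
composite softmax policy `π^λ`, then for every policy `π'`: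
`V̄^{π^λ,†}_1(s₁) + V̄^{π^λ,r}_1[κ](s₁) + λ·V̲^{π^λ,u}_1(s₁)
  ≥ V^{π',B_†β}_{P,1}(s₁) + V^{π',r}_{P,1}[κ](s₁) + λ·V^{π',u−2C_pβ}_{P,1}(s₁)`. -/
theorem composite_softmax_optimism
    {S A : Type*} [Fintype S] [Fintype A] [Nonempty S] [Nonempty A]
    (H : ℕ) (hH : 1 ≤ H)
    (P : ℕ → S → A → S → ℝ)
    (hP : ∀ h s a, (∀ s', 0 ≤ P h s a s') ∧ ∑ s', P h s a s' = 1)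
    (Phat : ℕ → (S → ℝ) → S → A → ℝ)
    (s₁ : S) (Cr Cp Cd Bd κ lam : ℝ)
    (hCr : 0 < Cr) (hCp : 0 < Cp) (hCd : 0 < Cd) (hBd : 0 ≤ Bd)
    (hκ : 0 < κ) (hlam : 0 ≤ lam)
    (r u β : ℕ → S → A → ℝ)
    (hr : ∀ h s a, r h s a ∈ Set.Icc (0:ℝ) 1)
    (hu : ∀ h s a, u h s a ∈ Set.Icc (0:ℝ) 1)
    (hβ : ∀ h s a, β h s a ∈ Set.Icc (0:ℝ) 1)
    (haccR : ∀ h ∈ Finset.Icc 1 H, ∀ s a,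
      |Phat h (fun s' => (ClipTripleV Phat r u β Cr Cp Cd Bd κ lam H (h + 1) s').2.1) s a
        - ∑ s', P h s a s' * (ClipTripleV Phat r u β Cr Cp Cd Bd κ lam H (h + 1) s').2.1|
          ≤ Cr * β h s a)
    (haccU : ∀ h ∈ Finset.Icc 1 H, ∀ s a,
      |Phat h (fun s' => (ClipTripleV Phat r u β Cr Cp Cd Bd κ lam H (h + 1) s').2.2) s a
        - ∑ s', P h s a s' * (ClipTripleV Phat r u β Cr Cp Cd Bd κ lam H (h + 1) s').2.2|
          ≤ Cp * β h s a)
    (haccD : ∀ h ∈ Finset.Icc 1 H, ∀ s a,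
      |Phat h (fun s' => (ClipTripleV Phat r u β Cr Cp Cd Bd κ lam H (h + 1) s').1) s a
        - ∑ s', P h s a s' * (ClipTripleV Phat r u β Cr Cp Cd Bd κ lam H (h + 1) s').1|
          ≤ Cd * β h s a) :
    ∀ π' : ℕ → S → A → ℝ,
      (∀ h s, (∀ a, 0 ≤ π' h s a) ∧ ∑ a, π' h s a = 1) →
      (ClipTripleV Phat r u β Cr Cp Cd Bd κ lam H 1 s₁).1
        + (ClipTripleV Phat r u β Cr Cp Cd Bd κ lam H 1 s₁).2.1
        + lam * (ClipTripleV Phat r u β Cr Cp Cd Bd κ lam H 1 s₁).2.2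
      ≥ Vval H P π' (fun h s a => Bd * β h s a) 0 1 s₁
        + Vval H P π' r κ 1 s₁
        + lam * Vval H P π' (fun h s a => u h s a - 2 * Cp * β h s a) 0 1 s₁ := by
  intro π' hπ'
  exact composite_Vaux_le_clipTripleAux P hP Phat r u β Cr Cp Cd Bd κ lam hBd hκ hlam
    (fun h s a => (hr h s a).2) (fun h s a => (hu h s a).2) (fun h s a => (hβ h s a).2) H
    haccR haccU haccD π' hπ' (H + 1 - 1) 1 (by omega) le_rfl s₁
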